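/- Let λ = (λ_1,…,λ_m) ∈ W^odd admit a chain of degree d ≤ (1^m) from the identity coset to λ. If j̄ = 2n+3−j ∈ {λ_1,…,λ_m} for some j with 2 ≤ j ≤ m, then λ ⪯ δ^j = (j̄ | 2 | ⋯ | j−1 | 1 | j+1 | ⋯ | m). -/

import Mathlib

/-- Roots of `R⁺ \ R_P⁺`: the formal symbols `t_i - t_j`, `t_i + t_j` and `2 t_i`. -/
inductive OddRoot : Type where
  | tminus (i j : ℕ) : OddRoot
  | tplus (i j : ℕ) : OddRoot
  | double (i : ℕ) : OddRoot
deriving DecidableEq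

namespace OddRoot

/-- The conditions for a formal symbol to be a root of `R⁺ \ R_P⁺`. -/
def valid (n m : ℕ) : OddRoot → Prop
  | tminus i j => 1 ≤ i ∧ i ≤ m ∧ i < j ∧ j ≤ n + 1
  | tplus i j => 1 ≤ i ∧ i ≤ m ∧ i < j ∧ j ≤ n + 1
  | double i => 1 ≤ i ∧ i ≤ m

/-- The reflection associated to a root, as a (signed) permutation of the
ground set `{1,…,2n+2}` inside `ℕ`, where `ī = 2n+3-i`. -/
def refl (n : ℕ) : OddRoot → Equiv.Perm ℕ
  | tminus i j => Equiv.swap i j * Equiv.swap (2*n+3-i) (2*n+3-j)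
  | tplus i j => Equiv.swap i (2*n+3-j) * Equiv.swap j (2*n+3-i)
  | double i => Equiv.swap i (2*n+3-i)

/-- The degree vector of a root: `deg α k` is the coefficient of the `k`-th
simple coroot in `α∨`. -/
def deg : OddRoot → ℕ → ℤ
  | tminus i j, k => if i ≤ k ∧ k < j then 1 else 0
  | tplus i j, k => (if i ≤ k then (1:ℤ) else 0) + (if j ≤ k then 1 else 0)
  | double i, k => if i ≤ k then 1 else 0

end OddRoot

/-- The total degree of a chain of roots. -/
def chainDeg (L : List OddRoot) (k : ℕ) : ℤ := (L.map (fun α => α.deg k)).sum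

/-- `IsChainTo n m L lam` : the sequence of roots `L = [α₁,…,α_t]` is a chain from the
identity coset to the tuple `lam`, i.e. each `αᵢ` is in `R⁺ \ R_P⁺` and the composite
`w = s_{α₁} ∘ ⋯ ∘ s_{α_t}` satisfies `w i = lam i` for `1 ≤ i ≤ m`. -/
def IsChainTo (n m : ℕ) (L : List OddRoot) (lam : ℕ → ℕ) : Prop :=
  (∀ α ∈ L, α.valid n m) ∧
  ∀ i ∈ Finset.Icc 1 m, ((L.map (OddRoot.refl n)).prod) i = lam i

/-- `W^odd`: tuples `(lam 1, …, lam m)` of pairwise distinct elements of `{1,…,2n+1}`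
with no two entries summing to `2n+3`. -/
def Wodd (n m : ℕ) (lam : ℕ → ℕ) : Prop :=
  (∀ i ∈ Finset.Icc 1 m, lam i ∈ Finset.Icc 1 (2*n+1)) ∧
  (∀ i ∈ Finset.Icc 1 m, ∀ j ∈ Finset.Icc 1 m, i ≠ j → lam i ≠ lam j) ∧
  (∀ i ∈ Finset.Icc 1 m, ∀ j ∈ Finset.Icc 1 m, lam i + lam j ≠ 2*n+3)

/-- `LamEntry lam k i = Λᵏᵢ`, the `i`-th smallest element of `{lam 1, …, lam k}`. -/
def LamEntry (lam : ℕ → ℕ) (k i : ℕ) : ℕ :=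
  (((Finset.Icc 1 k).image lam).sort (· ≤ ·)).getD (i-1) 0

/-- The Bruhat-type order `λ ⪯ δ`: `Λᵏᵢ ≤ Δᵏᵢ` for all `1 ≤ i ≤ k ≤ m`. -/
def Dominates (m : ℕ) (lam del : ℕ → ℕ) : Prop :=
  ∀ k ∈ Finset.Icc 1 m, ∀ i ∈ Finset.Icc 1 k, LamEntry lam k i ≤ LamEntry del k i

/-- The tuples `δʲ`: `δ¹ = ((m+1)̄ | 2 | 3 | ⋯ | m)` and, for `2 ≤ j ≤ m`,
`δʲ = (j̄ | 2 | ⋯ | j-1 | 1 | j+1 | ⋯ | m)`. -/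
def delta (n m j : ℕ) : ℕ → ℕ := fun i =>
  if j = 1 then (if i = 1 then 2*n+2-m else i)
  else if i = 1 then 2*n+3-j else if i = j then 1 else i

/-- The pattern vector `(0^a 1^b c^(m-a-b))`. -/
def patvec (a b : ℕ) (c : ℤ) : ℕ → ℤ := fun k =>
  if k ≤ a then 0 else if k ≤ a + b then 1 else c

/-- The simple reflections `s_k` (`1 ≤ k ≤ n`, swapping `k ↔ k+1` and `k̄ ↔ (k+1)̄`)
and `s_{n+1}` (swapping `n+1 ↔ (n+1)̄ = n+2`). -/
def simpleRefl (n k : ℕ) : Equiv.Perm ℕ :=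
  if k ≤ n then Equiv.swap k (k+1) * Equiv.swap (2*n+3-k) (2*n+2-k)
  else Equiv.swap (n+1) (n+2)

lemma odd_R1 (α : OddRoot) (k : ℕ) : 0 ≤ α.deg k := by
  cases α <;> simp only [OddRoot.deg] <;> split_ifs <;> norm_num

lemma odd_inv {n m : ℕ} (hmn : m ≤ n) (α : OddRoot) (h : α.valid n m) :
    (α.refl n)⁻¹ = α.refl n := by
  apply inv_eq_of_mul_eq_one_left
  ext x
  cases α <;> simp only [OddRoot.valid, OddRoot.refl, Equiv.Perm.mul_apply, Equiv.swap_apply_def,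
    Equiv.Perm.one_apply] at * <;> grind

lemma odd_R2 {n m : ℕ} (hmn : m ≤ n) (α : OddRoot) (h : α.valid n m) (k : ℕ) (hk : k ≤ m)
    (hd : α.deg k = 0) (x : ℕ) (hx : x ≤ k) : α.refl n x ≤ k := by
  cases α <;> simp only [OddRoot.valid, OddRoot.refl, OddRoot.deg, Equiv.Perm.mul_apply,
    Equiv.swap_apply_def] at * <;> grind

lemma odd_R3 {n m : ℕ} (hmn : m ≤ n) (α : OddRoot) (h : α.valid n m) (k : ℕ) (hk : k ≤ m)
    (hd : α.deg k ≤ 1) (x y : ℕ) (hx : x ≤ k) (hy : y ≤ k) (hx' : k < α.refl n x)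
    (hy' : k < α.refl n y) : x = y := by
  cases α <;> simp only [OddRoot.valid, OddRoot.refl, OddRoot.deg, Equiv.Perm.mul_apply,
    Equiv.swap_apply_def] at * <;> grind

lemma odd_R4 {n m : ℕ} (hmn : m ≤ n) (α : OddRoot) (h : α.valid n m) (x : ℕ) (hx : 1 ≤ x)
    (hx' : x ≤ 2*n+2) : 1 ≤ α.refl n x ∧ α.refl n x ≤ 2*n+2 ∧
      α.refl n (2*n+3-x) = 2*n+3 - α.refl n x := by
  cases α <;> simp only [OddRoot.valid, OddRoot.refl, Equiv.Perm.mul_apply,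
    Equiv.swap_apply_def] at * <;> grind

lemma odd_R5 {n m : ℕ} (hmn : m ≤ n) (α : OddRoot) (h : α.valid n m) : α.refl n 0 = 0 := by
  cases α <;> simp only [OddRoot.valid, OddRoot.refl, Equiv.Perm.mul_apply,
    Equiv.swap_apply_def] at * <;> grind

lemma odd_deg_cons (α : OddRoot) (L : List OddRoot) (k : ℕ) :
    chainDeg (α :: L) k = α.deg k + chainDeg L k := by simp [chainDeg]

lemma odd_P0 (L : List OddRoot) (k : ℕ) : 0 ≤ chainDeg L k := by
  induction L with
  | nil => simp [chainDeg]
  | cons α L ih => rw [odd_deg_cons]; have := odd_R1 α k; omega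

lemma odd_P1 {n m : ℕ} (hmn : m ≤ n) (L : List OddRoot) (h : ∀ α ∈ L, α.valid n m) (k : ℕ)
    (hk : k ≤ m) (hd : chainDeg L k = 0) (x : ℕ) (hx : x ≤ k) :
    ((L.map (OddRoot.refl n)).prod)⁻¹ x ≤ k := by
  induction L generalizing x with
  | nil => simpa using hx
  | cons α L ih =>
    rw [odd_deg_cons] at hd
    have h1 := odd_R1 α k
    have h2 := odd_P0 L k
    have hα := h α (by simp)
    rw [List.map_cons, List.prod_cons, mul_inv_rev, odd_inv hmn α hα, Equiv.Perm.mul_apply]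
    exact ih (fun β hβ => h β (by simp [hβ])) (by omega) _
      (odd_R2 hmn α hα k hk (by omega) x hx)

lemma odd_P2 {n m : ℕ} (hmn : m ≤ n) (L : List OddRoot) (h : ∀ α ∈ L, α.valid n m) (k : ℕ)
    (hk : k ≤ m) (hd : chainDeg L k ≤ 1) (x y : ℕ) (hx : x ≤ k) (hy : y ≤ k)
    (hx' : k < ((L.map (OddRoot.refl n)).prod)⁻¹ x)
    (hy' : k < ((L.map (OddRoot.refl n)).prod)⁻¹ y) : x = y := by
  induction L generalizing x y with
  | nil => simp at hx'; omega
  | cons α L ih =>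
    rw [odd_deg_cons] at hd
    have h1 := odd_R1 α k
    have h2 := odd_P0 L k
    have hα := h α (by simp)
    have hL : ∀ β ∈ L, β.valid n m := fun β hβ => h β (by simp [hβ])
    rw [List.map_cons, List.prod_cons, mul_inv_rev, odd_inv hmn α hα, Equiv.Perm.mul_apply]
      at hx' hy'
    by_cases h0 : α.deg k = 0
    · exact (α.refl n).injective (ih hL (by omega) _ _ (odd_R2 hmn α hα k hk h0 x hx)
        (odd_R2 hmn α hα k hk h0 y hy) hx' hy')
    · have hz : chainDeg L k = 0 := by omega
      refine odd_R3 hmn α hα k hk (by omega) x y hx hy ?_ ?_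
      · by_contra hc
        have := odd_P1 hmn L hL k hk hz _ (not_lt.mp hc)
        omega
      · by_contra hc
        have := odd_P1 hmn L hL k hk hz _ (not_lt.mp hc)
        omega

lemma odd_P4 {n m : ℕ} (hmn : m ≤ n) (L : List OddRoot) (h : ∀ α ∈ L, α.valid n m)
    (x : ℕ) (hx : 1 ≤ x) (hx' : x ≤ 2*n+2) :
    1 ≤ (L.map (OddRoot.refl n)).prod x ∧ (L.map (OddRoot.refl n)).prod x ≤ 2*n+2 ∧
      (L.map (OddRoot.refl n)).prod (2*n+3-x) = 2*n+3 - (L.map (OddRoot.refl n)).prod x := by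
  induction L with
  | nil => simp; omega
  | cons α L ih =>
    obtain ⟨a, b, c⟩ := ih (fun β hβ => h β (by simp [hβ]))
    rw [List.map_cons, List.prod_cons, Equiv.Perm.mul_apply, Equiv.Perm.mul_apply, c]
    exact odd_R4 hmn α (h α (by simp)) _ a b

lemma odd_P5 {n m : ℕ} (hmn : m ≤ n) (L : List OddRoot) (h : ∀ α ∈ L, α.valid n m) :
    (L.map (OddRoot.refl n)).prod 0 = 0 := by
  induction L with
  | nil => simp
  | cons α L ih =>
    rw [List.map_cons, List.prod_cons, Equiv.Perm.mul_apply,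
      ih (fun β hβ => h β (by simp [hβ])), odd_R5 hmn α (h α (by simp))]

/-- Counting criterion for comparing sorted lists entrywise. -/
lemma odd_sort_le (A B : Finset ℕ) (hAB : A.card = B.card)
    (h : ∀ x, (B.filter (· ≤ x)).card ≤ (A.filter (· ≤ x)).card) (i : ℕ) :
    (A.sort (· ≤ ·)).getD i 0 ≤ (B.sort (· ≤ ·)).getD i 0 := by
  by_cases hi : i < B.card
  swap
  · rw [List.getD_eq_default _ _ (by simp; omega)]
    omega
  set f := A.orderEmbOfFin hAB with hf
  set g := B.orderEmbOfFin rfl with hg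
  have e1 : (A.sort (· ≤ ·)).getD i 0 = f ⟨i, hi⟩ := by
    rw [List.getD_eq_getElem _ _ (by simp; omega)]; rfl
  have e2 : (B.sort (· ≤ ·)).getD i 0 = g ⟨i, hi⟩ := by
    rw [List.getD_eq_getElem _ _ (by simp; omega)]; rfl
  rw [e1, e2]
  by_contra hc
  push Not at hc
  have h1 : (Finset.Iic (⟨i, hi⟩ : Fin B.card)).card ≤ (B.filter (· ≤ g ⟨i, hi⟩)).card := by
    rw [← Finset.card_map g.toEmbedding]
    apply Finset.card_le_card
    intro y hy
    simp only [Finset.mem_map, Finset.mem_Iic] at hy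
    obtain ⟨a, ha, rfl⟩ := hy
    simp only [Finset.mem_filter]
    exact ⟨Finset.orderEmbOfFin_mem _ _ _, g.monotone ha⟩
  have h2 : (A.filter (· ≤ g ⟨i, hi⟩)).card ≤ (Finset.Iio (⟨i, hi⟩ : Fin B.card)).card := by
    rw [← Finset.card_map f.toEmbedding]
    apply Finset.card_le_card
    intro y hy
    simp only [Finset.mem_filter] at hy
    obtain ⟨hyA, hyle⟩ := hy
    have : y ∈ Set.range f := by rw [hf, Finset.range_orderEmbOfFin]; exact hyA
    obtain ⟨a, rfl⟩ := this
    simp only [Finset.mem_map, Finset.mem_Iio]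
    exact ⟨a, f.lt_iff_lt.mp (lt_of_le_of_lt hyle hc), rfl⟩
  have h3 := h (g ⟨i, hi⟩)
  simp at h1 h2
  omega

/-- Lemma `lem:cont` part (2): if `λ ∈ W^odd` is reached from the identity
coset by a chain of degree `d ≤ (1^m)` and `j̄ = 2n+3-j ∈ {λ₁,…,λ_m}` for some `2 ≤ j ≤ m`,
then `λ ⪯ δʲ = (j̄ | 2 | ⋯ | j-1 | 1 | j+1 | ⋯ | m)`. -/
theorem below_delta_j (n m : ℕ) (hn : 1 ≤ n) (hm : 1 ≤ m) (hmn : m ≤ n)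
    (lam : ℕ → ℕ) (hlam : Wodd n m lam)
    (L : List OddRoot) (hchain : IsChainTo n m L lam)
    (hdeg : ∀ k ∈ Finset.Icc 1 m, chainDeg L k ≤ 1)
    (j : ℕ) (hj2 : 2 ≤ j) (hjm : j ≤ m)
    (hbar : ∃ i ∈ Finset.Icc 1 m, lam i = 2*n+3-j) :
    Dominates m lam (delta n m j) := by
  obtain ⟨hval, hw⟩ := hchain
  set w := (L.map (OddRoot.refl n)).prod with hwdef
  obtain ⟨p, hp, hpj⟩ := hbar
  have hp' := Finset.mem_Icc.mp hp
  have hwp : w p = 2*n+3-j := (hw p hp).trans hpj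
  have hwpb : w (2*n+3-p) = j := by
    have := (odd_P4 hmn L hval p (by omega) (by omega)).2.2
    rw [← hwdef, hwp] at this
    omega
  have hinvj : w⁻¹ j = 2*n+3-p := by rw [Equiv.Perm.inv_eq_iff_eq]; exact hwpb.symm
  have hB : ∀ k, 1 ≤ k → k ≤ m → ∀ x y, x ≤ k → y ≤ k → k < w⁻¹ x → k < w⁻¹ y → x = y :=
    fun k h1 hk x y hx hy hx' hy' =>
      odd_P2 hmn L hval k hk (hdeg k (Finset.mem_Icc.mpr ⟨h1, hk⟩)) x y hx hy hx' hy'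
  have hle : ∀ i ∈ Finset.Icc 1 m, lam i ≤ 2*n+3-j := by
    intro i hi
    have hi' := Finset.mem_Icc.mp hi
    by_contra hc
    obtain ⟨a, b, c⟩ := odd_P4 hmn L hval i (by omega) (by omega)
    rw [← hwdef, hw i hi] at a b c
    have e : w⁻¹ (2*n+3-lam i) = 2*n+3-i := by rw [Equiv.Perm.inv_eq_iff_eq]; exact c.symm
    have := hB m hm le_rfl (2*n+3-lam i) j (by omega) hjm (by rw [e]; omega)
      (by rw [hinvj]; omega)
    omega
  have hmem : ∀ k, k ≤ m → ∀ y, 1 ≤ y → w⁻¹ y ≤ k → y ∈ (Finset.Icc 1 k).image lam := by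
    intro k hk y hy hyk
    have h0 : w⁻¹ y ≠ 0 := by
      intro h0
      rw [Equiv.Perm.inv_eq_iff_eq, hwdef, odd_P5 hmn L hval] at h0
      omega
    refine Finset.mem_image.mpr ⟨w⁻¹ y, Finset.mem_Icc.mpr ⟨by omega, hyk⟩, ?_⟩
    rw [← hw _ (Finset.mem_Icc.mpr ⟨by omega, by omega⟩)]
    simp
  intro k hk i hi
  have hk' := Finset.mem_Icc.mp hk
  have hcA : ((Finset.Icc 1 k).image lam).card = k := by
    rw [Finset.card_image_of_injOn]
    · simp
    · intro a ha b hb hab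
      by_contra hne
      simp only [Finset.coe_Icc, Set.mem_Icc] at ha hb
      exact hlam.2.1 a (Finset.mem_Icc.mpr ⟨ha.1, by omega⟩) b
        (Finset.mem_Icc.mpr ⟨hb.1, by omega⟩) hne hab
  have hcB : ((Finset.Icc 1 k).image (delta n m j)).card = k := by
    rw [Finset.card_image_of_injOn]
    · simp
    · intro a ha b hb hab
      simp only [Finset.coe_Icc, Set.mem_Icc] at ha hb
      simp only [delta] at hab
      grind
  unfold LamEntry
  apply odd_sort_le _ _ (hcA.trans hcB.symm)
  intro x
  by_cases hx : 2*n+3-j ≤ x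
  · have : ((Finset.Icc 1 k).image lam).filter (· ≤ x) = (Finset.Icc 1 k).image lam := by
      apply Finset.filter_true_of_mem
      intro y hy
      obtain ⟨i, hi, rfl⟩ := Finset.mem_image.mp hy
      have hi' := Finset.mem_Icc.mp hi
      have := hle i (Finset.mem_Icc.mpr ⟨by omega, by omega⟩)
      omega
    rw [this, hcA]
    exact (Finset.card_filter_le _ _).trans hcB.le
  · by_cases hjk : j ≤ k
    · apply Finset.card_le_card
      intro y hy
      obtain ⟨hyB, hyx⟩ := Finset.mem_filter.mp hy
      obtain ⟨i, hi, hiy⟩ := Finset.mem_image.mp hyB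
      have hi' := Finset.mem_Icc.mp hi
      have hy3 : 1 ≤ y ∧ y ≤ k ∧ y ≠ j := by
        simp only [delta] at hiy
        grind
      refine Finset.mem_filter.mpr ⟨hmem k hk'.2 y hy3.1 ?_, hyx⟩
      by_contra hc
      exact hy3.2.2 (hB k hk'.1 hk'.2 y j hy3.2.1 hjk (by omega) (by rw [hinvj]; omega))
    · have hBs : ((Finset.Icc 1 k).image (delta n m j)).filter (· ≤ x) ⊆
          Finset.Icc 2 (min x k) := by
        intro y hy
        obtain ⟨hyB, hyx⟩ := Finset.mem_filter.mp hy
        obtain ⟨i, hi, hiy⟩ := Finset.mem_image.mp hyB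
        have hi' := Finset.mem_Icc.mp hi
        simp only [delta] at hiy
        rw [Finset.mem_Icc]
        grind
      have hAs : ∃ z, (Finset.Icc 1 (min x k)).erase z ⊆
          ((Finset.Icc 1 k).image lam).filter (· ≤ x) := by
        by_cases hz : ∃ z, z ≤ k ∧ k < w⁻¹ z
        · obtain ⟨z, hz1, hz2⟩ := hz
          refine ⟨z, fun y hy => ?_⟩
          obtain ⟨hyz, hy⟩ := Finset.mem_erase.mp hy
          have hy' := Finset.mem_Icc.mp hy
          refine Finset.mem_filter.mpr ⟨hmem k hk'.2 y hy'.1 ?_, by omega⟩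
          by_contra hc
          exact hyz (hB k hk'.1 hk'.2 y z (by omega) hz1 (by omega) hz2)
        · push Not at hz
          refine ⟨0, fun y hy => ?_⟩
          have hy' := Finset.mem_Icc.mp (Finset.mem_erase.mp hy).2
          exact Finset.mem_filter.mpr ⟨hmem k hk'.2 y hy'.1 (hz y (by omega)), by omega⟩
      obtain ⟨z, hz⟩ := hAs
      have h1 := Finset.card_le_card hBs
      have h2 := Finset.card_le_card hz
      have h3 := Finset.pred_card_le_card_erase (s := Finset.Icc 1 (min x k)) (a := z)
      simp only [Nat.card_Icc] at h1 h3
      omega
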